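/- Let g ∈ G. Assume that b is continuous in the second variable, that B°g(y) > −∞ for all y ∈ Y, and that B°g ∈ F_c. Then Bf = g has a solution f ∈ F if, and only if, {(∂°g)⁻¹(y)}_{y∈Y} is a covering of X. In that case g(x) < +∞ for all x ∈ X. -/

import Mathlib

noncomputable def Bop {X Y : Type*} (b : X → Y → EReal → EReal) (f : Y → EReal) : X → EReal :=
  fun x => ⨆ y, b x y (f y)

noncomputable def Bgal {X Y : Type*} (bo : Y → X → EReal → EReal) (g : X → EReal) : Y → EReal :=
  fun y => ⨆ x, bo y x (g x)

/-- Subdifferential of `f` at `y` with respect to the kernel `b`. -/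
def subdiff {X Y : Type*} (b : X → Y → EReal → EReal) (S : Set (X × Y))
    (f : Y → EReal) (y : Y) : Set X :=
  {x | (x, y) ∈ S ∧ Bop b f x = b x y (f y)}

/-- Subdifferential of `g` at `x` with respect to the kernel `b°`. -/
def subdiffo {X Y : Type*} (bo : Y → X → EReal → EReal) (S : Set (X × Y))
    (g : X → EReal) (x : X) : Set Y :=
  {y | (x, y) ∈ S ∧ Bgal bo g y = bo y x (g x)}

/-- `(∂°g)⁻¹(y)`. -/
def subdiffoInv {X Y : Type*} (bo : Y → X → EReal → EReal) (S : Set (X × Y))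
    (g : X → EReal) (y : Y) : Set X :=
  {x | y ∈ subdiffo bo S g x}

def ldom {Z : Type*} (h : Z → EReal) : Set Z := {z | h z < ⊤}
def udom {Z : Type*} (h : Z → EReal) : Set Z := {z | ⊥ < h z}
def edom {Z : Type*} (h : Z → EReal) : Set Z := ldom h ∩ udom h
def idom {Z : Type*} [TopologicalSpace Z] (h : Z → EReal) : Set Z :=
  {z | z ∈ edom h ∧ Filter.limsup h (nhds z) < ⊤}

/-- `b` is continuous in the second variable. -/
def Cont2 {X Y : Type*} [TopologicalSpace Y] (b : X → Y → EReal → EReal) : Prop :=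
  ∀ (x : X) (α : ℝ), Continuous fun y => b x y (α : EReal)

/-- `b` is coercive. -/
def Coercive {X Y : Type*} [TopologicalSpace X] [TopologicalSpace Y]
    (b : X → Y → EReal → EReal) (bo : Y → X → EReal → EReal) : Prop :=
  ∀ x : X, ∀ V ∈ nhds x, ∀ (α β : ℝ),
    IsCompact (closure {y : Y | (⨆ z ∈ V, b z y (bo y x (α : EReal))) ≤ (β : EReal)})

/-- `f ∈ F_c`: relatively compact finite superlevel sets. -/
def MemFc {X Y : Type*} [TopologicalSpace Y] (b : X → Y → EReal → EReal)
    (f : Y → EReal) : Prop :=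
  ∀ (x : X) (β : ℝ), IsCompact (closure {y : Y | (β : EReal) ≤ b x y (f y)})

/-- `f` solves Problem (P') for the data `g`, `X'`. -/
def IsSolution {X Y : Type*} [TopologicalSpace Y] (b : X → Y → EReal → EReal)
    (g : X → EReal) (X' : Set X) (f : Y → EReal) : Prop :=
  LowerSemicontinuous f ∧ (∀ x, Bop b f x ≤ g x) ∧ ∀ x ∈ X', Bop b f x = g x

def SemiOpen {Z : Type*} [TopologicalSpace Z] (s : Set Z) : Prop :=
  s ⊆ closure (interior s)

def QuasiContinuous {Z W : Type*} [TopologicalSpace Z] [TopologicalSpace W]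
    (h : Z → W) : Prop :=
  ∀ G : Set W, IsOpen G → SemiOpen (h ⁻¹' G)

/-- `h` is quasi-continuous on its domain. -/
def QuasiContinuousOnDom {Z : Type*} [TopologicalSpace Z] (h : Z → EReal) : Prop :=
  QuasiContinuous fun z : edom h => h z.1

/-- `y` is algebraically essential with respect to the covering of `W'` by `{Fm z}_{z ∈ Z'}`. -/
def AlgEssential {Z W : Type*} (Fm : Z → Set W) (Z' : Set Z) (W' : Set W) (y : Z) : Prop :=
  y ∈ Z' ∧ ∃ w ∈ W', ∀ z ∈ Z' \ {y}, w ∉ Fm z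

/-- `y` is topologically essential with respect to the covering of `W'` by `{Fm z}_{z ∈ Z'}`. -/
def TopEssential {Z W : Type*} [TopologicalSpace Z] (Fm : Z → Set W) (Z' : Set Z)
    (W' : Set W) (y : Z) : Prop :=
  y ∈ Z' ∧ ∀ U : Set Z, IsOpen U → y ∈ U → ∃ w ∈ W', ∀ z ∈ Z' \ U, w ∉ Fm z

theorem antitone_of_galois {α β : Type*} [Preorder α] [Preorder β] {u : α → β} {v : β → α}
    (h : ∀ a c, u a ≤ c ↔ v c ≤ a) : Antitone u :=
  fun _ a₂ ha => (h a₂ _).2 (((h _ _).1 le_rfl).trans ha)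

theorem galois_apply_apply_of_injective {α β : Type*} [PartialOrder α] [PartialOrder β]
    {u : α → β} {v : β → α} (h : ∀ a c, u a ≤ c ↔ v c ≤ a) (hu : Function.Injective u) (a : α) :
    v (u a) = a :=
  hu <| ((h _ _).2 le_rfl).antisymm (antitone_of_galois h ((h _ _).1 le_rfl))

theorem Bop_le_iff_Bgal_le {X Y : Type*} {b : X → Y → EReal → EReal}
    {bo : Y → X → EReal → EReal} (hgal : ∀ x y α β, b x y α ≤ β ↔ bo y x β ≤ α)
    (f : Y → EReal) (g : X → EReal) : Bop b f ≤ g ↔ Bgal bo g ≤ f := by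
  simp only [Pi.le_def, Bop, Bgal, iSup_le_iff, hgal]
  exact forall_comm

/-- An antitone kernel which is continuous in the second variable gives an upper semicontinuous
function along a lower semicontinuous function avoiding `⊥`. -/
theorem upperSemicontinuous_kernel_comp {Y : Type*} [TopologicalSpace Y]
    {k : Y → EReal → EReal} {F : Y → EReal} (hanti : ∀ y, Antitone (k y))
    (hsurj : ∀ y, Function.Surjective (k y) ∨ ∀ α, k y α = ⊥)
    (hcont : ∀ α : ℝ, Continuous fun y => k y α)
    (hF : LowerSemicontinuous F) (hbot : ∀ y, F y ≠ ⊥) :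
    UpperSemicontinuous fun y => k y (F y) := by
  intro y₀ γ hγ
  obtain ⟨α, hα, hαγ⟩ : ∃ α : ℝ, (α : EReal) < F y₀ ∧ k y₀ α < γ := by
    rcases hsurj y₀ with h | h
    · obtain ⟨δ, hδ, hδγ⟩ := exists_between hγ
      obtain ⟨α', rfl⟩ := h δ
      have hα' : α' < F y₀ := lt_of_not_ge fun hle => hδ.not_ge (hanti y₀ hle)
      obtain ⟨α, h₁, h₂⟩ := EReal.exists_between_coe_real hα'
      exact ⟨α, h₂, (hanti y₀ h₁.le).trans_lt hδγ⟩
    · obtain ⟨α, -, h₂⟩ := EReal.exists_between_coe_real (bot_lt_iff_ne_bot.2 (hbot y₀))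
      exact ⟨α, h₂, by simpa only [h] using hγ⟩
  filter_upwards [hF y₀ α hα, (hcont α).continuousAt.eventually_lt_const hαγ] with y h₁ h₂
  exact (hanti y h₁.le).trans_lt h₂

/-- An upper semicontinuous function with relatively compact real superlevel sets attains its
supremum, provided the latter is not `⊥`. -/
theorem UpperSemicontinuous.exists_eq_iSup_of_isCompact_closure {Y : Type*} [TopologicalSpace Y]
    {h : Y → EReal} (hh : UpperSemicontinuous h)
    (hc : ∀ β : ℝ, IsCompact (closure {y | (β : EReal) ≤ h y})) (hne : ⨆ y, h y ≠ ⊥) :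
    ∃ y, h y = ⨆ y, h y := by
  obtain ⟨β, -, hβ⟩ := EReal.exists_between_coe_real (bot_lt_iff_ne_bot.2 hne)
  obtain ⟨y₁, hy₁⟩ := lt_iSup_iff.1 hβ
  have hmem : y₁ ∈ closure {y | (β : EReal) ≤ h y} := subset_closure hy₁.le
  obtain ⟨y, -, hy⟩ := (hh.upperSemicontinuousOn _).exists_isMaxOn ⟨y₁, hmem⟩ (hc β)
  refine ⟨y, (le_iSup h y).antisymm (iSup_le fun z => ?_)⟩
  by_cases hz : (β : EReal) ≤ h z
  · exact hy (subset_closure hz)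
  · exact (not_le.1 hz).le.trans (hy₁.le.trans (hy hmem))

/-- Existence criterion when `b` is continuous in the second variable, `B°g > -∞`
and `B°g ∈ F_c`; in that case `g < +∞` everywhere. -/
theorem stmt9
    {X Y : Type*} [TopologicalSpace X] [TopologicalSpace Y] [T2Space X] [T2Space Y]
    (b : X → Y → EReal → EReal) (bo : Y → X → EReal → EReal) (S : Set (X × Y))
    (hgal : ∀ (x : X) (y : Y) (α β : EReal), b x y α ≤ β ↔ bo y x β ≤ α)
    (hbo_lsc : ∀ (x : X) (α : EReal), LowerSemicontinuous fun y => bo y x α)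
    (hS1 : ∀ x : X, ∃ y : Y, (x, y) ∈ S)
    (hS2 : ∀ y : Y, ∃ x : X, (x, y) ∈ S)
    (hS3 : ∀ x y, (x, y) ∈ S → Function.Bijective (b x y))
    (hS4 : ∀ x y, (x, y) ∉ S → ∀ α : EReal, b x y α = ⊥)
    (g : X → EReal)
    (hcont : Cont2 b)
    (hbot : ∀ y : Y, Bgal bo g y ≠ ⊥)
    (hfc : MemFc b (Bgal bo g)) :
    ((∃ f : Y → EReal, LowerSemicontinuous f ∧ Bop b f = g) ↔
      (Set.univ : Set X) ⊆ ⋃ y : Y, subdiffoInv bo S g y) ∧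
    ((∃ f : Y → EReal, LowerSemicontinuous f ∧ Bop b f = g) → ∀ x : X, g x < ⊤) := by
  have hanti : ∀ x y, Antitone (b x y) := fun x y => antitone_of_galois (hgal x y)
  have hinv : ∀ x y, (x, y) ∈ S → ∀ α, bo y x (b x y α) = α := fun x y hxy =>
    galois_apply_apply_of_injective (hgal x y) (hS3 x y hxy).injective
  have hFlsc : LowerSemicontinuous (Bgal bo g) :=
    lowerSemicontinuous_iSup fun x => hbo_lsc x (g x)
  have hle : Bop b (Bgal bo g) ≤ g := (Bop_le_iff_Bgal_le hgal _ _).2 le_rfl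
  have hbb : ∀ x y, b x y (Bgal bo g y) ≤ g x := fun x y =>
    (le_iSup (fun y => b x y (Bgal bo g y)) y).trans (hle x)
  have key : (∃ f : Y → EReal, LowerSemicontinuous f ∧ Bop b f = g) →
      ∀ x, ∃ y, (x, y) ∈ S ∧ b x y (Bgal bo g y) = g x := by
    rintro ⟨f, -, hf⟩ x
    have hBF : ⨆ y, b x y (Bgal bo g y) = g x := by
      refine (hle x).antisymm ?_
      conv_lhs => rw [← hf]
      exact iSup_mono fun y => hanti x y ((Bop_le_iff_Bgal_le hgal _ _).1 hf.le y)
    by_cases hx : g x = ⊥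
    · obtain ⟨y, hy⟩ := hS1 x
      exact ⟨y, hy, by simpa [hx] using hbb x y⟩
    · have husc : UpperSemicontinuous fun y => b x y (Bgal bo g y) :=
        upperSemicontinuous_kernel_comp (hanti x)
          (fun y => (em ((x, y) ∈ S)).imp (fun h => (hS3 x y h).surjective) (hS4 x y))
          (hcont x) hFlsc hbot
      obtain ⟨y, hy⟩ := husc.exists_eq_iSup_of_isCompact_closure (hfc x) (hBF ▸ hx)
      replace hy : b x y (Bgal bo g y) = g x := hy.trans hBF
      exact ⟨y, by_contra fun hn => hx (hy ▸ hS4 x y hn _), hy⟩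
  refine ⟨⟨fun h x _ => ?_, fun h => ⟨Bgal bo g, hFlsc, ?_⟩⟩, fun h x => ?_⟩
  · obtain ⟨y, hy, hyg⟩ := key h x
    exact Set.mem_iUnion.2 ⟨y, hy, by rw [← hyg, hinv x y hy]⟩
  · refine funext fun x => (hle x).antisymm ?_
    obtain ⟨y, hy, hyF⟩ := Set.mem_iUnion.1 (h (Set.mem_univ x))
    obtain ⟨α, hα⟩ := (hS3 x y hy).surjective (g x)
    refine le_trans (le_of_eq ?_) (le_iSup (fun y => b x y (Bgal bo g y)) y)
    simp only [hyF, ← hα, hinv x y hy]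
  · obtain ⟨y, hy, hyg⟩ := key h x
    refine lt_top_iff_ne_top.2 fun htop => hbot y ((hS3 x y hy).injective ?_)
    have := hanti x y (bot_le : ⊥ ≤ Bgal bo g y)
    rw [hyg, htop] at this
    rw [hyg, htop, top_le_iff.1 this]
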